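/- Let k ≥ 1 be an integer, let a ∈ ℂ, and let x ∈ ℂ with x ≠ a. Suppose γ₁, …, γ_N are pairwise non-homotopic x-loops in the complement of {a} such that none of them passes through x, each has fewer than k self-intersections, and every pair of them cross fewer than k times. Then N ≤ 2k + 1. (In the paper's notation, f(1,k) ≤ 2k+1.) -/

import Mathlib

open unitInterval

/-- `γ` does not pass through `x` : its interior avoids the basepoint. -/
def AvoidsBase {A : Set ℂ} {x : ℂ} {hx : x ∉ A}
    (γ : Path (X := {z : ℂ // z ∉ A}) ⟨x, hx⟩ ⟨x, hx⟩) : Prop :=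
  ∀ t : I, t ≠ 0 → t ≠ 1 → (γ t : ℂ) ≠ x

/-- `γ` has fewer than `k` self-intersections: the set
`{(s,t) : 0 < s < t < 1, γ s = γ t}` has fewer than `k` elements. -/
def SelfIntersLt {A : Set ℂ} {x : ℂ} {hx : x ∉ A}
    (γ : Path (X := {z : ℂ // z ∉ A}) ⟨x, hx⟩ ⟨x, hx⟩) (k : ℕ) : Prop :=
  {p : I × I | p.1 ≠ 0 ∧ p.2 ≠ 1 ∧ p.1 < p.2 ∧ γ p.1 = γ p.2}.encard < (k : ℕ∞)

/-- `γ` and `γ'` cross fewer than `k` times: the set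
`{(s,t) ∈ (0,1)² : γ s = γ' t}` has fewer than `k` elements. -/
def CrossingsLt {A : Set ℂ} {x : ℂ} {hx : x ∉ A}
    (γ γ' : Path (X := {z : ℂ // z ∉ A}) ⟨x, hx⟩ ⟨x, hx⟩) (k : ℕ) : Prop :=
  {p : I × I | p.1 ≠ 0 ∧ p.1 ≠ 1 ∧ p.2 ≠ 0 ∧ p.2 ≠ 1 ∧ γ p.1 = γ' p.2}.encard < (k : ℕ∞)

/-- A nowhere vanishing continuous function on a simply connected, locally path-connected space has
a continuous logarithm with a prescribed value at a point. -/
theorem exists_continuous_log {X : Type*} [TopologicalSpace X] [SimplyConnectedSpace X]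
    [LocallyPathConnectedSpace X] {f : X → ℂ} (hf : Continuous f) (h0 : ∀ y, f y ≠ 0)
    {y₀ : X} {e₀ : ℂ} (he : Complex.exp e₀ = f y₀) :
    ∃ L : X → ℂ, Continuous L ∧ L y₀ = e₀ ∧ ∀ y, Complex.exp (L y) = f y := by
  obtain ⟨L, ⟨hL0, hL⟩, -⟩ := Complex.isCoveringMapOn_exp.existsUnique_continuousMap_lifts
    ⟨f, hf⟩ he (by simpa using h0)
  exact ⟨L, L.continuous, hL0, fun y => congrFun hL y⟩

/-- The planar Poincaré–Miranda theorem on the rectangle `[P, Q] × [A, B]`. -/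
theorem exists_zero_of_rectangle {H : ℝ × ℝ → ℂ} (hH : Continuous H) {P Q A B : ℝ}
    (hPQ : P ≤ Q) (hA : ∀ s ∈ Set.Icc P Q, (H (s, A)).re < 0)
    (hB : ∀ s ∈ Set.Icc P Q, 0 < (H (s, B)).re) (hP : ∀ t, (H (P, t)).im ≤ 0)
    (hQ : ∀ t, 0 ≤ (H (Q, t)).im) :
    ∃ s ∈ Set.Icc P Q, ∃ t, H (s, t) = 0 := by
  by_contra! hne
  let c : ℝ → ℝ := fun s => Set.projIcc P Q hPQ s
  have hc : Continuous c := continuous_subtype_val.comp continuous_projIcc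
  have hcm : ∀ s, c s ∈ Set.Icc P Q := fun s => (Set.projIcc P Q hPQ s).2
  have hcP : c P = P := by simp [c]
  have hcQ : c Q = Q := by simp [c]
  have hK : Continuous fun p : ℝ × ℝ => H (c p.1, p.2) := by fun_prop
  have hPA := hA P ⟨le_rfl, hPQ⟩
  have hPA0 : -H (P, A) ≠ 0 := fun h => by simp [neg_eq_zero.mp h] at hPA
  obtain ⟨L, hLc, hL0, hL⟩ := exists_continuous_log hK (fun p => hne _ (hcm _) _)
    (y₀ := (P, A)) (e₀ := Complex.log (-H (P, A)) - Real.pi * Complex.I) (by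
      rw [Complex.exp_sub, Complex.exp_log hPA0, Complex.exp_pi_mul_I, hcP]; simp)
  have hθc : Continuous fun p => (L p).im := Complex.continuous_im.comp hLc
  have hre : ∀ p, (H (c p.1, p.2)).re = Real.exp (L p).re * Real.cos (L p).im := fun p => by
    rw [← hL p, Complex.exp_re]
  have him : ∀ p, (H (c p.1, p.2)).im = Real.exp (L p).re * Real.sin (L p).im := fun p => by
    rw [← hL p, Complex.exp_im]
  have hcosA : ∀ s, Real.cos (L (s, A)).im < 0 := fun s => by
    have := hA _ (hcm s)
    rw [hre (s, A)] at this
    exact neg_of_mul_neg_right this (Real.exp_pos _).le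
  have hcosB : ∀ s, 0 < Real.cos (L (s, B)).im := fun s => by
    have := hB _ (hcm s)
    rw [hre (s, B)] at this
    exact pos_of_mul_pos_right this (Real.exp_pos _).le
  have hsinP : ∀ t, Real.sin (L (P, t)).im ≤ 0 := fun t => by
    have := hP t
    rw [← hcP, him (P, t)] at this
    exact nonpos_of_mul_nonpos_right this (Real.exp_pos _)
  have hsinQ : ∀ t, 0 ≤ Real.sin (L (Q, t)).im := fun t => by
    have := hQ t
    rw [← hcQ, him (Q, t)] at this
    exact nonneg_of_mul_nonneg_right this (Real.exp_pos _)
  have pi_pos := Real.pi_pos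
  -- The bounds on the argument of `H` at the four corners come from the sides joining them.
  have side : ∀ {φ : ℝ → ℝ}, Continuous φ → ∀ {a b v : ℝ}, φ a ≤ v → v ≤ φ b → ∃ y, φ y = v :=
    fun hφ _ _ _ h1 h2 => mem_range_of_exists_le_of_exists_ge hφ ⟨_, h1⟩ ⟨_, h2⟩
  have hsA : Continuous fun s => (L (s, A)).im := by fun_prop
  have hsB : Continuous fun s => (L (s, B)).im := by fun_prop
  have htP : Continuous fun t => (L (P, t)).im := by fun_prop
  have htQ : Continuous fun t => (L (Q, t)).im := by fun_prop
  have hu : -Real.pi ≤ (L (P, A)).im ∧ (L (P, A)).im < -(Real.pi / 2) := by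
    have h1 : 0 ≤ (-H (P, A)).arg := Complex.arg_nonneg_iff.mpr (by simpa using hP A)
    have h2 : (-H (P, A)).arg < Real.pi / 2 :=
      Complex.arg_lt_pi_div_two_iff.mpr (Or.inl (by simpa using hPA))
    rw [hL0]
    simp only [Complex.sub_im, Complex.log_im, Complex.mul_im, Complex.ofReal_re, Complex.I_im,
      Complex.ofReal_im, Complex.I_re]
    constructor <;> linarith
  have hv : -(Real.pi / 2) < (L (P, B)).im ∧ (L (P, B)).im ≤ 0 := by
    have h1 : (L (P, B)).im ≤ 0 := by
      by_contra! h
      obtain ⟨y, hy⟩ := side htP (a := A) (b := B) (v := min (L (P, B)).im (Real.pi / 2))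
        (le_min (by linarith) (by linarith)) (min_le_left _ _)
      have := hsinP y
      rw [hy] at this
      exact this.not_gt (Real.sin_pos_of_pos_of_lt_pi (lt_min h (by linarith))
        ((min_le_right _ _).trans_lt (by linarith)))
    have h2 : -Real.pi ≤ (L (P, B)).im := by
      by_contra! h
      obtain ⟨y, hy⟩ := side htP (a := B) (b := A) (v := max (L (P, B)).im (-(3 * Real.pi / 2)))
        (le_max_left _ _) (max_le (by linarith) (by linarith))
      have := hsinP y
      rw [hy, ← Real.sin_add_two_pi] at this
      refine this.not_gt (Real.sin_pos_of_pos_of_lt_pi ?_ ?_)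
      · linarith [le_max_right (L (P, B)).im (-(3 * Real.pi / 2))]
      · linarith [max_lt h (show -(3 * Real.pi / 2) < -Real.pi by linarith)]
    refine ⟨?_, h1⟩
    by_contra! h
    have := hcosB P
    rw [← Real.cos_neg] at this
    exact this.not_ge (Real.cos_nonpos_of_pi_div_two_le_of_le (by linarith) (by linarith))
  have hz : 0 ≤ (L (Q, B)).im ∧ (L (Q, B)).im < Real.pi / 2 := by
    have h1 : (L (Q, B)).im < Real.pi / 2 := by
      by_contra! h
      obtain ⟨y, hy⟩ := side hsB (a := P) (b := Q) (v := Real.pi / 2) (by linarith) h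
      have := hcosB y
      rw [hy] at this
      simp at this
    have h2 : -(Real.pi / 2) < (L (Q, B)).im := by
      by_contra! h
      obtain ⟨y, hy⟩ := side hsB (a := Q) (b := P) (v := -(Real.pi / 2)) h (by linarith)
      have := hcosB y
      rw [hy] at this
      simp at this
    refine ⟨?_, h1⟩
    by_contra! h
    exact (hsinQ B).not_gt (Real.sin_neg_of_neg_of_neg_pi_lt h (by linarith))
  have hw : 0 ≤ (L (Q, A)).im := by
    by_contra! h
    obtain ⟨y, hy⟩ := side htQ (a := A) (b := B) (v := max (L (Q, A)).im (-(Real.pi / 2)))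
      (le_max_left _ _) (max_le (by linarith) (by linarith))
    have := hsinQ y
    rw [hy] at this
    refine this.not_gt (Real.sin_neg_of_neg_of_neg_pi_lt (max_lt h (by linarith)) ?_)
    exact lt_max_of_lt_right (by linarith)
  obtain ⟨y, hy⟩ := side hsA (a := P) (b := Q) (v := 0) (by linarith) hw
  have := hcosA y
  rw [hy] at this
  norm_num at this

/-- A continuous planar curve that advances by `n` over each period has, between a point of maximal
height and a later point of minimal height, the start of a horizontal chord of signed length `m`. -/
theorem exists_chord_of_max_of_min {F : ℝ → ℂ} (hF : Continuous F) {n : ℝ} (hn : 0 < n)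
    (hper : ∀ (t : ℝ) (j : ℤ), F (t + j) = F t + j * n) (m : ℝ) {P Q : ℝ} (hPQ : P ≤ Q)
    (hP : ∀ t, (F t).im ≤ (F P).im) (hQ : ∀ t, (F Q).im ≤ (F t).im) :
    ∃ s ∈ Set.Icc P Q, ∃ t, F t = F s + m := by
  obtain ⟨M, hM⟩ := (isCompact_Icc (a := P) (b := Q)).exists_bound_of_continuousOn hF.continuousOn
  obtain ⟨j, hj⟩ := exists_nat_gt ((M + |m| + |(F 0).re|) / n)
  rw [div_lt_iff₀ hn] at hj
  have hre : ∀ i : ℤ, (F i).re = (F 0).re + i * n := fun i => by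
    have := congrArg Complex.re (hper 0 i)
    simpa using this
  have hbd : ∀ s ∈ Set.Icc P Q, |(F s).re| ≤ M := fun s hs =>
    (Complex.abs_re_le_norm _).trans (hM s hs)
  have hcont : Continuous fun p : ℝ × ℝ => F p.2 - F p.1 - m := by fun_prop
  obtain ⟨s, hs, t, h⟩ := exists_zero_of_rectangle hcont hPQ
    (A := ((-j : ℤ) : ℝ)) (B := ((j : ℤ) : ℝ))
    (fun s hs => by
      have := abs_le.mp (hbd s hs)
      have h1 := hre (-j)
      simp only [Complex.sub_re, Complex.ofReal_re, h1]
      push_cast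
      linarith [neg_abs_le m, le_abs_self (F 0).re])
    (fun s hs => by
      have := abs_le.mp (hbd s hs)
      have h1 := hre j
      simp only [Complex.sub_re, Complex.ofReal_re, h1]
      push_cast
      linarith [le_abs_self m, neg_abs_le (F 0).re])
    (fun t => by simpa using hP t) (fun t => by simpa using hQ t)
  exact ⟨s, hs, t, by linear_combination h⟩

/-- A continuous planar curve that advances by `n` over each period has, up to the period, at least
two horizontal chords of signed length `m`, for every `0 < m < n`. -/
theorem exists_two_chords {F : ℝ → ℂ} (hF : Continuous F) {n : ℝ}
    (hper : ∀ (t : ℝ) (j : ℤ), F (t + j) = F t + j * n) {m : ℝ} (hm : 0 < m) (hmn : m < n) :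
    ∃ s₁ t₁ s₂ t₂, F t₁ = F s₁ + m ∧ F t₂ = F s₂ + m ∧ Int.fract s₁ ≠ Int.fract s₂ := by
  have hn : 0 < n := hm.trans hmn
  have him : ∀ (t : ℝ) (j : ℤ), (F (t + j)).im = (F t).im := fun t j => by
    simpa using congrArg Complex.im (hper t j)
  have himf : ∀ t : ℝ, (F (Int.fract t)).im = (F t).im := fun t => by
    conv_rhs => rw [← Int.fract_add_floor t, him]
  have hg : Continuous fun t => (F t).im := by fun_prop
  have hfr : ∀ t : ℝ, Int.fract t ∈ Set.Icc (0 : ℝ) 1 := fun t =>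
    ⟨Int.fract_nonneg t, (Int.fract_lt_one t).le⟩
  obtain ⟨P₀, -, hP₀⟩ := (isCompact_Icc (a := (0 : ℝ)) (b := 1)).exists_isMaxOn
    ⟨0, by simp⟩ hg.continuousOn
  obtain ⟨Q₀, -, hQ₀⟩ := (isCompact_Icc (a := (0 : ℝ)) (b := 1)).exists_isMinOn
    ⟨0, by simp⟩ hg.continuousOn
  replace hP₀ : ∀ t, (F t).im ≤ (F P₀).im := fun t => himf t ▸ hP₀ (hfr t)
  replace hQ₀ : ∀ t, (F Q₀).im ≤ (F t).im := fun t => himf t ▸ hQ₀ (hfr t)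
  by_contra! hall
  have shift : ∀ P Q : ℝ, ∃ j : ℤ, P ≤ Q + j ∧ Q + j ≤ P + 1 := fun P Q =>
    ⟨⌈P - Q⌉, by linarith [Int.le_ceil (P - Q)], by linarith [Int.ceil_lt_add_one (P - Q)]⟩
  obtain ⟨j₀, hj₀, -⟩ := shift P₀ Q₀
  obtain ⟨s₀, -, t₀, h₀⟩ := exists_chord_of_max_of_min hF hn hper m hj₀ hP₀
    (fun t => by rw [him]; exact hQ₀ t)
  have hst : Int.fract t₀ ≠ Int.fract s₀ := fun h => by
    obtain ⟨j, hj⟩ := Int.fract_eq_fract.mp h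
    rw [show t₀ = s₀ + j by linarith, hper] at h₀
    have h1 : (j : ℝ) * n = m := by exact_mod_cast add_left_cancel h₀
    have h2 : (0 : ℝ) < j := by
      by_contra! h
      nlinarith
    have h3 : (1 : ℝ) ≤ j := by exact_mod_cast h2
    nlinarith
  have himst : (F t₀).im = (F s₀).im := by simpa using congrArg Complex.im h₀
  have move : ∀ R : ℝ, ∃ R', (F R').im = (F R).im ∧ Int.fract R' ≠ Int.fract s₀ := fun R => by
    by_cases h : Int.fract R = Int.fract s₀
    · exact ⟨t₀, by rw [himst, ← himf s₀, ← h, himf], hst⟩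
    · exact ⟨R, rfl, h⟩
  obtain ⟨P, hPP, hPs⟩ := move P₀
  obtain ⟨Q₁, hQQ, hQs₁⟩ := move Q₀
  obtain ⟨j, hPQ, hQP⟩ := shift P Q₁
  set Q := Q₁ + j with hQdef
  have hQs : Int.fract Q ≠ Int.fract s₀ := by rwa [hQdef, Int.fract_add_intCast]
  have hP : ∀ t, (F t).im ≤ (F P).im := fun t => hPP ▸ hP₀ t
  have hQ : ∀ t, (F Q).im ≤ (F t).im := fun t => by rw [hQdef, him, hQQ]; exact hQ₀ t
  obtain ⟨s₁, ⟨hs₁P, hs₁Q⟩, t₁, h₁⟩ := exists_chord_of_max_of_min hF hn hper m hPQ hP hQ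
  obtain ⟨s₂, ⟨hs₂Q, hs₂P⟩, t₂, h₂⟩ := exists_chord_of_max_of_min
    (F := fun t => (starRingEnd ℂ) (F t)) (by fun_prop) hn (fun t j => by simp [hper]) m hQP
    (fun t => by simpa using hQ t)
    (fun t => by
      have := him P 1
      simp only [Int.cast_one] at this
      simpa [this] using hP t)
  replace h₂ : F t₂ = F s₂ + m := by
    have := congrArg (starRingEnd ℂ) h₂
    simpa using this
  have e₁ := hall _ _ _ _ h₁ h₀
  have e₂ := hall _ _ _ _ h₂ h₀
  obtain ⟨i, hi⟩ := Int.fract_eq_fract.mp (e₂.trans e₁.symm)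
  have hi0 : (0 : ℝ) ≤ i := by linarith
  have hi1 : (i : ℝ) ≤ 1 := by linarith
  norm_cast at hi0 hi1
  obtain rfl | rfl : i = 0 ∨ i = 1 := by omega
  · have : s₁ = Q := by push_cast at hi; linarith
    exact hQs (this ▸ e₁)
  · have : s₁ = P := by push_cast at hi; linarith
    exact hPs (this ▸ e₁)

/-- A planar path from `0` to `n` with no integer value in between has at least `n - 1` pairs of
interior times at which its values differ by an integer. -/
theorem le_encard_integer_chords {G : ℝ → ℂ} (hG : Continuous G) {n : ℕ} (hG0 : G 0 = 0)
    (hG1 : G 1 = n) (hint : ∀ t ∈ Set.Ioo (0 : ℝ) 1, ∀ j : ℤ, G t ≠ j) :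
    ((n - 1 : ℕ) : ℕ∞) ≤
      {p : ℝ × ℝ | 0 < p.1 ∧ p.2 < 1 ∧ p.1 < p.2 ∧ ∃ j : ℤ, G p.2 = G p.1 + j}.encard := by
  set S := {p : ℝ × ℝ | 0 < p.1 ∧ p.2 < 1 ∧ p.1 < p.2 ∧ ∃ j : ℤ, G p.2 = G p.1 + j} with hS
  let F : ℝ → ℂ := fun t => G (Int.fract t) + ⌊t⌋ * (n : ℝ)
  have hF : Continuous F := by
    have h : Continuous ((fun u : ℝ => G u - u * (n : ℂ)) ∘ Int.fract) :=
      ContinuousOn.comp_fract'' (by fun_prop) (by simp [hG0, hG1])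
    have h2 : F = fun t => ((fun u : ℝ => G u - u * (n : ℂ)) ∘ Int.fract) t + t * (n : ℂ) := by
      funext t
      have h3 : (t : ℂ) = (Int.fract t : ℝ) + (⌊t⌋ : ℂ) := by
        exact_mod_cast (Int.fract_add_floor t).symm
      simp only [F, Function.comp_apply]
      rw [h3]
      push_cast
      ring
    rw [h2]
    fun_prop
  have hper : ∀ (t : ℝ) (j : ℤ), F (t + j) = F t + j * (n : ℝ) := fun t j => by
    simp only [F, Int.fract_add_intCast, Int.floor_add_intCast]
    push_cast
    ring
  have key : ∀ m : Fin (n - 1), ∃ s t : Bool → ℝ,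
      (∀ b, F (t b) = F (s b) + (m + 1 : ℕ)) ∧ Int.fract (s true) ≠ Int.fract (s false) := by
    intro m
    have hm : ((m + 1 : ℕ) : ℝ) < n := by
      have := m.2
      exact_mod_cast (by omega : (m : ℕ) + 1 < n)
    obtain ⟨s₁, t₁, s₂, t₂, h₁, h₂, hne⟩ := exists_two_chords hF hper
      (m := (m + 1 : ℕ)) (by positivity) hm
    refine ⟨fun b => if b then s₁ else s₂, fun b => if b then t₁ else t₂, ?_, by simpa using hne⟩
    rintro (_ | _)
    · simpa using h₂
    · simpa using h₁
  choose s t hchord hne using key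
  have hG : ∀ m b, G (Int.fract (t m b)) =
      G (Int.fract (s m b)) + (((m + 1 : ℕ) + n * (⌊s m b⌋ - ⌊t m b⌋) : ℤ) : ℂ) := fun m b => by
    have := hchord m b
    simp only [F] at this
    push_cast at this ⊢
    linear_combination this
  have hnz : ∀ (m : Fin (n - 1)) (i : ℤ), ((m + 1 : ℕ) + n * i : ℤ) ≠ 0 := fun m i h => by
    have h1 : (n : ℤ) ∣ (m + 1 : ℕ) := ⟨-i, by linarith⟩
    have h2 := Nat.le_of_dvd (Nat.succ_pos _) (Int.natCast_dvd_natCast.mp h1)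
    have := m.2
    omega
  have hpos : ∀ u : ℝ, (∃ j : ℤ, G (Int.fract u) = j) → Int.fract u = 0 := fun u ⟨j, hj⟩ => by
    by_contra h
    exact hint _ ⟨lt_of_le_of_ne (Int.fract_nonneg u) (Ne.symm h), Int.fract_lt_one u⟩ j hj
  have hs : ∀ m b, 0 < Int.fract (s m b) := fun m b => by
    refine lt_of_le_of_ne (Int.fract_nonneg _) fun h => hnz m (⌊s m b⌋ - ⌊t m b⌋) ?_
    have h1 := hG m b
    rw [← h, hG0, zero_add] at h1
    rw [hpos _ ⟨_, h1⟩, hG0] at h1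
    exact_mod_cast h1.symm
  have ht : ∀ m b, 0 < Int.fract (t m b) := fun m b => by
    refine lt_of_le_of_ne (Int.fract_nonneg _) fun h => (hs m b).ne' (hpos _
      ⟨-((m + 1 : ℕ) + n * (⌊s m b⌋ - ⌊t m b⌋)), ?_⟩)
    have h1 := hG m b
    rw [← h, hG0] at h1
    push_cast at h1 ⊢
    linear_combination -h1
  have hst : ∀ m b, Int.fract (s m b) ≠ Int.fract (t m b) := fun m b h => by
    have h1 := hG m b
    rw [h, left_eq_add] at h1
    exact hnz m _ (by exact_mod_cast h1)
  let z : Fin (n - 1) × Bool → ℝ × ℝ := fun c => (Int.fract (s c.1 c.2), Int.fract (t c.1 c.2))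
  have hz : Function.Injective z := by
    rintro ⟨m, b⟩ ⟨m', b'⟩ h
    obtain ⟨h1, h2⟩ := Prod.mk.inj h
    dsimp only at h1 h2
    have h3 := hG m b
    rw [h1, h2, hG m' b', add_right_inj] at h3
    norm_cast at h3
    have hmm : m = m' := by
      have h4 : ((m + 1 : ℕ) : ℤ) ≡ (m' + 1 : ℕ) [ZMOD n] := by
        refine Int.modEq_iff_dvd.mpr ⟨⌊s m b⌋ - ⌊t m b⌋ - (⌊s m' b'⌋ - ⌊t m' b'⌋), ?_⟩
        push_cast at h3 ⊢
        linarith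
      have h5 := Int.natCast_modEq_iff.mp h4
      have := m.2
      have := m'.2
      have h6 := h5.eq_of_lt_of_lt (by omega) (by omega)
      exact Fin.ext (by omega)
    subst hmm
    rcases b with _ | _ <;> rcases b' with _ | _
    · rfl
    · exact absurd h1.symm (hne m)
    · exact absurd h1 (hne m)
    · rfl
  have hsub : Set.range z ⊆ S ∪ Prod.swap '' S := by
    rintro _ ⟨⟨m, b⟩, rfl⟩
    rcases lt_or_gt_of_ne (hst m b) with h | h
    · exact Or.inl ⟨hs m b, Int.fract_lt_one _, h, _, hG m b⟩
    · refine Or.inr ⟨(z (m, b)).swap, ⟨ht m b, Int.fract_lt_one _, h,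
        -((m + 1 : ℕ) + n * (⌊s m b⌋ - ⌊t m b⌋)), ?_⟩, Prod.swap_swap _⟩
      have := hG m b
      simp only [z, Prod.fst_swap, Prod.snd_swap]
      push_cast at this ⊢
      linear_combination -this
  rcases S.finite_or_infinite with hfin | hinf
  · have h1 := Set.ncard_le_ncard hsub (hfin.union (hfin.image _))
    have h2 := Set.ncard_union_le S (Prod.swap '' S)
    rw [Set.ncard_image_of_injective _ Prod.swap_injective] at h2
    rw [← Set.image_univ, Set.ncard_image_of_injective _ hz, Set.ncard_univ, Nat.card_prod,
      Nat.card_fin, Nat.card_eq_fintype_card (α := Bool), Fintype.card_bool] at h1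
    rw [← hfin.cast_ncard_eq]
    exact_mod_cast (by omega : n - 1 ≤ S.ncard)
  · rw [hinf.encard_eq]
    exact le_top

/-- A loop in the punctured plane, in logarithmic coordinates centred at the puncture. -/
theorem exists_log_coordinate {a x : ℂ} {hx : x ∉ ({a} : Set ℂ)}
    (γ : Path (X := {z : ℂ // z ∉ ({a} : Set ℂ)}) ⟨x, hx⟩ ⟨x, hx⟩) :
    ∃ (G : ℝ → ℂ) (w : ℤ), Continuous G ∧ G 0 = 0 ∧ G 1 = w ∧
      ∀ t : I, (γ t : ℂ) = a + (x - a) * Complex.exp (2 * Real.pi * Complex.I * G t) := by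
  have hxa : x - a ≠ 0 := sub_ne_zero.mpr (by simpa using hx)
  have hc : Continuous fun t : ℝ => ((γ.extend t : ℂ) - a) / (x - a) := by fun_prop
  obtain ⟨L, hL, hL0, hexp⟩ := exists_continuous_log hc
    (fun t => div_ne_zero (sub_ne_zero.mpr (by simpa using (γ.extend t).2)) hxa)
    (y₀ := 0) (e₀ := 0) (by simp [hxa])
  have hτ : 2 * (Real.pi : ℂ) * Complex.I ≠ 0 := Complex.two_pi_I_ne_zero
  obtain ⟨w, hw⟩ := Complex.exp_eq_one_iff.mp (show Complex.exp (L 1) = 1 by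
    rw [hexp]; simp [hxa])
  refine ⟨fun t => L t / (2 * Real.pi * Complex.I), w, by fun_prop, by simp [hL0], ?_, fun t => ?_⟩
  · simp only [hw, mul_div_cancel_right₀ _ hτ]
  · rw [mul_div_cancel₀ _ hτ, hexp, mul_div_cancel₀ _ hxa, Path.extend_apply _ t.2]
    simp

theorem exp_two_pi_I_mul_eq_iff {z w : ℂ} :
    Complex.exp (2 * Real.pi * Complex.I * z) = Complex.exp (2 * Real.pi * Complex.I * w) ↔
      ∃ j : ℤ, z = w + j := by
  rw [Complex.exp_eq_exp_iff_exists_int]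
  refine exists_congr fun j => ⟨fun h => ?_, fun h => by rw [h]; ring⟩
  exact mul_left_cancel₀ Complex.two_pi_I_ne_zero (h.trans (by ring))

/-- Loops in the punctured plane with equal winding numbers are homotopic. -/
theorem homotopic_of_log_coordinate {a x : ℂ} {hx : x ∉ ({a} : Set ℂ)}
    {γ γ' : Path (X := {z : ℂ // z ∉ ({a} : Set ℂ)}) ⟨x, hx⟩ ⟨x, hx⟩} {G G' : ℝ → ℂ}
    (hG : Continuous G) (hG' : Continuous G') (h0 : G 0 = G' 0) (h1 : G 1 = G' 1)
    (hγ : ∀ t : I, (γ t : ℂ) = a + (x - a) * Complex.exp (2 * Real.pi * Complex.I * G t))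
    (hγ' : ∀ t : I, (γ' t : ℂ) = a + (x - a) * Complex.exp (2 * Real.pi * Complex.I * G' t)) :
    γ.Homotopic γ' := by
  have hxa : x - a ≠ 0 := sub_ne_zero.mpr (by simpa using hx)
  refine ⟨⟨⟨⟨fun p => ⟨a + (x - a) * Complex.exp (2 * Real.pi * Complex.I *
    ((1 - (p.1 : ℝ)) * G p.2 + (p.1 : ℝ) * G' p.2)), by simp [hxa]⟩, by fun_prop⟩, ?_, ?_⟩, ?_⟩⟩
  · intro t
    ext
    simp [hγ]
  · intro t
    ext
    simp [hγ']
  · rintro r t (rfl | rfl)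
    · ext
      have := hγ 0
      rw [γ.source, Set.Icc.coe_zero] at this
      simpa [← h0, ← add_mul] using this.symm
    · ext
      have := hγ 1
      rw [γ.target, Set.Icc.coe_one] at this
      simpa [← h1, ← add_mul] using this.symm

/-- A loop in the punctured plane with fewer than `k` self-intersections winds at most `k`
times around the puncture. -/
theorem natAbs_winding_le {a x : ℂ} {hx : x ∉ ({a} : Set ℂ)}
    {γ : Path (X := {z : ℂ // z ∉ ({a} : Set ℂ)}) ⟨x, hx⟩ ⟨x, hx⟩} {G : ℝ → ℂ} {w : ℤ}
    (hG : Continuous G) (hG0 : G 0 = 0) (hG1 : G 1 = w)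
    (hγ : ∀ t : I, (γ t : ℂ) = a + (x - a) * Complex.exp (2 * Real.pi * Complex.I * G t))
    (hbase : AvoidsBase γ) {k : ℕ} (hself : SelfIntersLt γ k) : w.natAbs ≤ k := by
  have hxa : x - a ≠ 0 := sub_ne_zero.mpr (by simpa using hx)
  have hγeq : ∀ s t : I, γ s = γ t ↔ ∃ j : ℤ, G t = G s + j := fun s t => by
    rw [← exp_two_pi_I_mul_eq_iff, eq_comm, Subtype.ext_iff, hγ, hγ]
    simp [hxa]
  have hint : ∀ t ∈ Set.Ioo (0 : ℝ) 1, ∀ j : ℤ, G t ≠ j := fun t ht j h => by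
    let u : I := ⟨t, ht.1.le, ht.2.le⟩
    refine hbase u (fun h => ht.1.ne' (congrArg Subtype.val h))
      (fun h => ht.2.ne (congrArg Subtype.val h)) ?_
    have h1 : γ 0 = γ u := (hγeq 0 u).mpr ⟨j, by simp [u, hG0, h]⟩
    rw [← h1, γ.source]
  have hle : {p : ℝ × ℝ | 0 < p.1 ∧ p.2 < 1 ∧ p.1 < p.2 ∧ ∃ j : ℤ, G p.2 = G p.1 + j}.encard ≤
      {p : I × I | p.1 ≠ 0 ∧ p.2 ≠ 1 ∧ p.1 < p.2 ∧ γ p.1 = γ p.2}.encard := by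
    refine (Set.encard_le_encard ?_).trans
      (Set.encard_image_le (Prod.map Subtype.val Subtype.val) _)
    rintro ⟨s, t⟩ ⟨hs, ht, hst, hj⟩
    dsimp only at hs ht hst hj
    exact ⟨(⟨s, hs.le, (hst.trans ht).le⟩, ⟨t, (hs.trans hst).le, ht.le⟩),
      ⟨fun h => hs.ne' (congrArg Subtype.val h), fun h => ht.ne (congrArg Subtype.val h), hst,
        (hγeq _ _).mpr hj⟩, rfl⟩
  have hlt : ((w.natAbs - 1 : ℕ) : ℕ∞) < k := by
    refine lt_of_le_of_lt ?_ (hle.trans_lt hself)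
    have hcast : ∀ v : ℤ, v = w.natAbs → (v : ℂ) = (w.natAbs : ℕ) := fun v h => by
      conv_lhs => rw [h]
      exact Int.cast_natCast _
    rcases Int.natAbs_eq w with hw | hw
    · exact le_encard_integer_chords hG hG0 (hG1.trans (hcast w hw)) hint
    · refine (le_encard_integer_chords (G := fun t => -G t) (n := w.natAbs) (by fun_prop)
        (by simp [hG0]) ?_ (fun t ht j h => hint t ht (-j) ?_)).trans (Set.encard_le_encard ?_)
      · rw [hG1, ← hcast (-w) (by omega), Int.cast_neg]
      · push_cast
        linear_combination -h
      · rintro p ⟨h1, h2, h3, j, hj⟩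
        refine ⟨h1, h2, h3, -j, ?_⟩
        push_cast
        linear_combination -hj
  have : w.natAbs - 1 < k := by exact_mod_cast hlt
  omega

/-- (`f(1,k) ≤ 2k+1`.) Pairwise non-homotopic `x`-loops in the
complement of a single point `a`, none passing through `x`, each with fewer than `k`
self-intersections and every pair crossing fewer than `k` times, number at most `2k+1`. -/
theorem loops_upper_bound_one_point (k N : ℕ) (hk : 1 ≤ k) (a x : ℂ) (hx : x ∉ ({a} : Set ℂ))
    (γ : Fin N → Path (X := {z : ℂ // z ∉ ({a} : Set ℂ)}) ⟨x, hx⟩ ⟨x, hx⟩)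
    (hhom : ∀ i j, i ≠ j → ¬ (γ i).Homotopic (γ j))
    (hbase : ∀ i, AvoidsBase (γ i))
    (hself : ∀ i, SelfIntersLt (γ i) k)
    (hcross : ∀ i j, i ≠ j → CrossingsLt (γ i) (γ j) k) :
    N ≤ 2 * k + 1 := by
  choose G w hG hG0 hG1 hγ using fun i => exists_log_coordinate (γ i)
  have hinj : Function.Injective w := fun i j h => by
    by_contra hij
    exact hhom i j hij (homotopic_of_log_coordinate (hG i) (hG j) (by rw [hG0, hG0])
      (by rw [hG1, hG1, h]) (hγ i) (hγ j))
  have hmem : Set.MapsTo w (Finset.univ : Finset (Fin N)) (Finset.Icc (-(k : ℤ)) k) := fun i _ => by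
    have := natAbs_winding_le (hG i) (hG0 i) (hG1 i) (hγ i) (hbase i) (hself i)
    rw [Finset.coe_Icc, Set.mem_Icc]
    omega
  have hcard := Finset.card_le_card_of_injOn w hmem hinj.injOn
  rw [Finset.card_univ, Fintype.card_fin, Int.card_Icc] at hcard
  omega
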